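/- Suppose 0 < p < ∞, r > 0 and μ is a positive Borel measure on 𝒰. Let (a_k) be a sequence in 𝒰 such that 𝒰 = ⋃_k D(a_k, r) and there is a positive integer N such that each point of 𝒰 belongs to at most N of the balls D(a_k, 2r). If there exists C > 0 with μ(D(a_k, r)) ≤ C ρ(a_k)^{n+1} for all k, then μ is a Carleson measure for Aᵖ(𝒰), i.e. there is C′ > 0 such that ∫_𝒰 |f|ᵖ dμ ≤ C′ ∫_𝒰 |f|ᵖ dV for all f ∈ Aᵖ(𝒰). -/

import Mathlib

open MeasureTheory Filter

noncomputable section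

/-- Points of ℂⁿ written `z = (z′, zₙ)` with `z′ ∈ ℂ^m`, `m = n - 1`. -/
abbrev SPoint (m : ℕ) := (Fin m → ℂ) × ℂ

/-- `ρ(z,w) = (i/2)(w̄ₙ − zₙ) − z′·w̄′`. -/
def srho2 {m : ℕ} (z w : SPoint m) : ℂ :=
  Complex.I / 2 * ((starRingEnd ℂ) w.2 - z.2) - ∑ j, z.1 j * (starRingEnd ℂ) (w.1 j)

/-- `ρ(z) = Im zₙ − |z′|²`. -/
def srho {m : ℕ} (z : SPoint m) : ℝ :=
  z.2.im - ∑ j, ‖z.1 j‖ ^ 2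

/-- The Siegel upper half-space `𝒰 = {z : ρ(z) > 0}`. -/
def Siegel (m : ℕ) : Set (SPoint m) := {z | 0 < srho z}

/-- The Bergman kernel `K(z,w) = (n!/(4πⁿ)) ρ(z,w)^{−(n+1)}` (points in ℂⁿ = ℂ^{n-1} × ℂ). -/
def sK (n : ℕ) (z w : SPoint (n - 1)) : ℂ :=
  (n.factorial : ℂ) / (4 * (Real.pi : ℂ) ^ n) * srho2 z w ^ (-(n + 1 : ℤ))

/-- Inverse hyperbolic tangent. -/
def artanh (x : ℝ) : ℝ := (1 / 2) * Real.log ((1 + x) / (1 - x))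

/-- The Bergman distance `β(z,w) = artanh √(1 − ρ(z)ρ(w)/|ρ(z,w)|²)`. -/
def sbeta {m : ℕ} (z w : SPoint m) : ℝ :=
  artanh (Real.sqrt (1 - srho z * srho w / ‖srho2 z w‖ ^ 2))

/-- The Bergman metric ball `D(z,r)`. -/
def sball {m : ℕ} (z : SPoint m) (r : ℝ) : Set (SPoint m) :=
  {w ∈ Siegel m | sbeta z w < r}

/-- Membership in the Bergman space `Aᵖ(𝒰)`: holomorphic with `∫_𝒰 |f|ᵖ dV < ∞`. -/
def MemAp (n : ℕ) (p : ℝ) (f : SPoint (n - 1) → ℂ) : Prop :=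
  DifferentiableOn ℂ f (Siegel (n - 1)) ∧
    IntegrableOn (fun z => ‖f z‖ ^ p) (Siegel (n - 1)) volume

/-- `‖f‖ₚ = (∫_𝒰 |f|ᵖ dV)^{1/p}`. -/
def bNorm (n : ℕ) (p : ℝ) (f : SPoint (n - 1) → ℂ) : ℝ :=
  (∫ z in Siegel (n - 1), ‖f z‖ ^ p) ^ (1 / p)

/-- The space `𝒮_α` of holomorphic `f` on `𝒰` with `sup_z |zₙ + i|^α |f(z)| < ∞`. -/
def SAlpha (n : ℕ) (α : ℝ) (f : SPoint (n - 1) → ℂ) : Prop :=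
  DifferentiableOn ℂ f (Siegel (n - 1)) ∧
    ∃ M : ℝ, ∀ z ∈ Siegel (n - 1), ‖z.2 + Complex.I‖ ^ α * ‖f z‖ ≤ M

end


/-- For `f` holomorphic near a closed disc, `log ‖f‖` satisfies the sub-mean value inequality. -/
theorem log_norm_le_circleAverage_log_norm {f : ℂ → ℂ} {c : ℂ} {R : ℝ} (hR : 0 < R)
    (hf : AnalyticOnNhd ℂ f (Metric.closedBall c R)) (hc : f c ≠ 0) :
    Real.log ‖f c‖ ≤ Real.circleAverage (fun z => Real.log ‖f z‖) c R := by
  have hf' : AnalyticOnNhd ℂ f (Metric.closedBall c |R|) := by rwa [abs_of_pos hR]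
  rw [hf'.circleAverage_log_norm hR.ne' hc]
  refine le_add_of_nonneg_left (finsum_nonneg fun u => ?_)
  by_cases hu : u ∈ Metric.closedBall c |R|
  · refine mul_nonneg ?_ ?_
    · exact_mod_cast MeromorphicOn.AnalyticOnNhd.divisor_nonneg hf' u
    · rcases eq_or_ne u c with rfl | hne
      · simp
      · apply Real.log_nonneg
        have h1 : 0 < ‖c - u‖ := norm_pos_iff.2 (sub_ne_zero.2 hne.symm)
        rw [← div_eq_mul_inv, one_le_div h1]
        rw [abs_of_pos hR, Metric.mem_closedBall, dist_comm, dist_eq_norm] at hu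
        exact hu
  · simp [hu]

/-- The sub-mean value inequality on circles for `‖f‖ ^ p`, with `f` holomorphic and `0 < p`. -/
theorem norm_rpow_le_circleAverage {f : ℂ → ℂ} {c : ℂ} {R p : ℝ} (hR : 0 < R) (hp : 0 < p)
    (hf : AnalyticOnNhd ℂ f (Metric.closedBall c R)) :
    ‖f c‖ ^ p ≤ Real.circleAverage (fun z => ‖f z‖ ^ p) c R := by
  classical
  rcases eq_or_ne (f c) 0 with hc | hc
  · rw [hc, norm_zero, Real.zero_rpow hp.ne']
    exact Real.circleAverage_nonneg_of_nonneg fun _ _ => Real.rpow_nonneg (norm_nonneg _) _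
  have hf' : AnalyticOnNhd ℂ f (Metric.closedBall c |R|) := by rwa [abs_of_pos hR]
  have hA : 0 < ‖f c‖ := norm_pos_iff.2 hc
  set A := ‖f c‖
  let G : ℂ → ℝ := fun z => A ^ p * (1 - p * Real.log A) + (A ^ p * p) * Real.log ‖f z‖
  let F : ℂ → ℝ := fun z => if f z = 0 then 0 else G z
  have hlog : CircleIntegrable (fun z => Real.log ‖f z‖) c R :=
    MeromorphicOn.circleIntegrable_log_norm
      (hf'.mono Metric.sphere_subset_closedBall).meromorphicOn
  have hG : CircleIntegrable G c R :=
    (circleIntegrable_const _ _ _).add (IntervalIntegrable.const_mul hlog _)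
  have hGF : G =ᶠ[codiscreteWithin (Metric.sphere c |R|)] F := by
    have h0 : f ⁻¹' {0}ᶜ ∈ codiscreteWithin (Metric.closedBall c |R|) :=
      hf'.preimage_zero_mem_codiscreteWithin hc (by simp)
        (Metric.isConnected_closedBall (abs_nonneg R))
    filter_upwards [codiscreteWithin_mono Metric.sphere_subset_closedBall h0] with z hz
    have hz' : f z ≠ 0 := hz
    simp [F, hz']
  have hF : CircleIntegrable F c R := hG.congr_codiscreteWithin hGF
  have hcont : CircleIntegrable (fun z => ‖f z‖ ^ p) c R := by
    apply ContinuousOn.circleIntegrable'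
    exact ((hf'.continuousOn.mono Metric.sphere_subset_closedBall).norm).rpow_const
      fun _ _ => Or.inr hp.le
  calc A ^ p = A ^ p * (1 - p * Real.log A) + (A ^ p * p) * Real.log A := by ring
    _ ≤ A ^ p * (1 - p * Real.log A) +
          (A ^ p * p) * Real.circleAverage (fun z => Real.log ‖f z‖) c R := by
        gcongr
        exact log_norm_le_circleAverage_log_norm hR hf hc
    _ = Real.circleAverage G c R := by
        have hlog' : CircleIntegrable (fun z => (A ^ p * p) * Real.log ‖f z‖) c R :=
          IntervalIntegrable.const_mul hlog _
        rw [Real.circleAverage_fun_add (circleIntegrable_const _ _ _) hlog',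
          Real.circleAverage_const]
        congr 1
        exact (Real.circleAverage_fun_smul (a := A ^ p * p)
          (f := fun z => Real.log ‖f z‖)).symm
    _ = Real.circleAverage F c R := Real.circleAverage_congr_codiscreteWithin hGF hR.ne'
    _ ≤ Real.circleAverage (fun z => ‖f z‖ ^ p) c R := by
        refine Real.circleAverage_mono hF hcont fun z _ => ?_
        by_cases hz : f z = 0
        · simp [F, hz, Real.zero_rpow hp.ne']
        · simp only [F, hz, if_false, G]
          have hz' : 0 < ‖f z‖ := norm_pos_iff.2 hz
          have h1 := Real.add_one_le_exp (p * (Real.log ‖f z‖ - Real.log A))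
          have h2 : ‖f z‖ ^ p = A ^ p * Real.exp (p * (Real.log ‖f z‖ - Real.log A)) := by
            rw [Real.rpow_def_of_pos hz', Real.rpow_def_of_pos hA, ← Real.exp_add]
            congr 1; ring
          rw [h2]
          have : 0 < A ^ p := Real.rpow_pos_of_pos hA p
          nlinarith [mul_le_mul_of_nonneg_left h1 this.le]

/-- Integration over a disc in polar coordinates centred at its centre. -/
theorem setLIntegral_ball_eq_polar {h : ℂ → ENNReal} (c : ℂ) (R : ℝ)
    (hh : Measurable ((Metric.ball c R).indicator h)) :
    ∫⁻ z in Metric.ball c R, h z = ∫⁻ t in Set.Ioo 0 R,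
      ENNReal.ofReal t * ∫⁻ θ in Set.Ioo (-Real.pi) Real.pi, h (circleMap c t θ) := by
  have hm : Measurable fun q : ℝ × ℝ => (Metric.ball c R).indicator h (circleMap c q.1 q.2) :=
    hh.comp (by unfold circleMap; fun_prop)
  have hsymm : ∀ q : ℝ × ℝ, c + Complex.polarCoord.symm q = circleMap c q.1 q.2 := by
    intro q
    rw [Complex.polarCoord_symm_apply, circleMap, Complex.exp_mul_I]
    simp
  rw [← lintegral_indicator measurableSet_ball,
    ← lintegral_add_left_eq_self (μ := volume) _ c, ← Complex.lintegral_comp_polarCoord_symm]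
  simp only [hsymm, polarCoord_target, smul_eq_mul]
  rw [Measure.volume_eq_prod, ← Measure.prod_restrict, lintegral_prod _ (by fun_prop),
    ← lintegral_indicator measurableSet_Ioi, ← lintegral_indicator measurableSet_Ioo]
  congr 1 with t
  by_cases ht0 : 0 < t
  · have hb : ∀ θ, circleMap c t θ ∈ Metric.ball c R ↔ t < R := by
      intro θ
      simp [Metric.mem_ball, dist_eq_norm, circleMap, abs_of_pos ht0]
    have hmt : Measurable fun θ : ℝ =>
        (Metric.ball c R).indicator h (circleMap c t θ) :=
      hh.comp (continuous_circleMap c t).measurable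
    by_cases htR : t < R
    · rw [Set.indicator_of_mem (by simpa using ht0),
        Set.indicator_of_mem (by exact ⟨ht0, htR⟩)]
      dsimp only
      rw [lintegral_const_mul _ hmt]
      simp only [Set.indicator, hb, htR, if_true]
    · rw [Set.indicator_of_mem (by simpa using ht0),
        Set.indicator_of_notMem (by simp [htR])]
      simp only [Set.indicator, hb, htR, if_false, mul_zero, lintegral_zero]
  · rw [Set.indicator_of_notMem (by simpa using ht0), Set.indicator_of_notMem (by simp [ht0])]

/-- A function continuous on a measurable set becomes measurable when extended by zero. -/
theorem ContinuousOn.measurable_indicator {α β : Type*} [TopologicalSpace α] [MeasurableSpace α]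
    [OpensMeasurableSpace α] [TopologicalSpace β] [MeasurableSpace β] [BorelSpace β] [Zero β]
    {f : α → β} {s : Set α} (hf : ContinuousOn f s) (hs : MeasurableSet s) :
    Measurable (s.indicator f) := by
  classical
  rw [← Set.piecewise_eq_indicator]
  exact hf.measurable_piecewise continuousOn_const hs

/-- The sub-mean value inequality on discs for `‖f‖ ^ p`. -/
theorem norm_rpow_mul_volume_ball_le {f : ℂ → ℂ} {c : ℂ} {R p : ℝ} (hp : 0 < p)
    (hf : DifferentiableOn ℂ f (Metric.ball c R)) :
    ENNReal.ofReal (‖f c‖ ^ p) * volume (Metric.ball c R) ≤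
      ∫⁻ z in Metric.ball c R, ENNReal.ofReal (‖f z‖ ^ p) := by
  have hcont : ContinuousOn (fun z => ‖f z‖ ^ p) (Metric.ball c R) :=
    hf.continuousOn.norm.rpow_const fun _ _ => Or.inr hp.le
  have hmeas : Measurable ((Metric.ball c R).indicator fun z => ENNReal.ofReal (‖f z‖ ^ p)) :=
    (ENNReal.continuous_ofReal.comp_continuousOn hcont).measurable_indicator measurableSet_ball
  rw [← setLIntegral_const, setLIntegral_ball_eq_polar c R
    (measurable_const.indicator measurableSet_ball), setLIntegral_ball_eq_polar c R hmeas]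
  refine setLIntegral_mono' measurableSet_Ioo fun t ht => mul_le_mul_right ?_ _
  have hsub : Metric.closedBall c t ⊆ Metric.ball c R := Metric.closedBall_subset_ball ht.2
  have han : AnalyticOnNhd ℂ f (Metric.closedBall c t) :=
    (hf.analyticOnNhd Metric.isOpen_ball).mono hsub
  have hint : Continuous fun θ => ‖f (circleMap c t θ)‖ ^ p :=
    hcont.comp_continuous (continuous_circleMap c t) fun θ =>
      hsub (circleMap_mem_closedBall c ht.1.le θ)
  have h := norm_rpow_le_circleAverage ht.1 hp han
  rw [Real.circleAverage_eq_integral_add (-Real.pi),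
    intervalIntegral.integral_comp_add_right (fun θ => ‖f (circleMap c t θ)‖ ^ p),
    show (0 : ℝ) + -Real.pi = -Real.pi by ring, show 2 * Real.pi + -Real.pi = Real.pi by ring,
    intervalIntegral.integral_of_le (by linarith [Real.pi_pos]), integral_Ioc_eq_integral_Ioo,
    smul_eq_mul, ← div_eq_inv_mul, le_div_iff₀ Real.two_pi_pos] at h
  rw [setLIntegral_const, Real.volume_Ioo, sub_neg_eq_add, ← two_mul,
    ← ENNReal.ofReal_mul (by positivity), ← ofReal_integral_eq_lintegral_ofReal
      ((hint.integrableOn_Icc).mono_set Set.Ioo_subset_Icc_self)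
      (Eventually.of_forall fun _ => by positivity)]
  exact ENNReal.ofReal_le_ofReal h

/-- The sub-mean value inequality on polydiscs of a finite product for `‖f‖ ^ p`. -/
theorem norm_rpow_mul_volume_pi_ball_le {ι : Type*} [Fintype ι] {f : (ι → ℂ) → ℂ} {c : ι → ℂ}
    {R p : ℝ} (hR : 0 < R) (hp : 0 < p) (hf : DifferentiableOn ℂ f (Metric.ball c R)) :
    ENNReal.ofReal (‖f c‖ ^ p) * volume (Metric.ball (0 : ℂ) R) ^ Fintype.card ι ≤
      ∫⁻ z in Metric.ball c R, ENNReal.ofReal (‖f z‖ ^ p) := by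
  classical
  set K := volume (Metric.ball (0 : ℂ) R)
  set h : (ι → ℂ) → ENNReal := (Metric.ball c R).indicator fun z => ENNReal.ofReal (‖f z‖ ^ p)
    with hh
  have hmeas : Measurable h :=
    (ENNReal.continuous_ofReal.comp_continuousOn (hf.continuousOn.norm.rpow_const
      fun _ _ => Or.inr hp.le)).measurable_indicator measurableSet_ball
  have key : ∀ s : Finset ι, ∀ x ∈ Metric.ball c R, (∀ j ∈ s, x j = c j) →
      h x * K ^ s.card ≤ (∫⋯∫⁻_s, h ∂fun _ => volume) x := by
    intro s
    induction s using Finset.induction_on with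
    | empty => intro x _ _; simp
    | insert i s hi ih =>
      intro x hx hxc
      have hupd : ∀ t ∈ Metric.ball (c i) R, Function.update x i t ∈ Metric.ball c R := by
        intro t ht
        rw [ball_pi _ hR] at hx ⊢
        intro j _
        rcases eq_or_ne j i with rfl | hj
        · simpa using ht
        · simpa [hj] using hx j trivial
      have hxi : Function.update x i (c i) = x := by
        rw [← hxc i (Finset.mem_insert_self i s), Function.update_eq_self]
      have hone : h x * K ≤ ∫⁻ t in Metric.ball (c i) R, h (Function.update x i t) := by
        have hdiff : DifferentiableOn ℂ (fun t => f (Function.update x i t))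
            (Metric.ball (c i) R) :=
          hf.comp (fun t _ => (hasFDerivAt_update x t).differentiableAt.differentiableWithinAt)
            hupd
        have := norm_rpow_mul_volume_ball_le hp hdiff
        simp only [hxi] at this
        rw [hh, Set.indicator_of_mem hx]
        have hK : K = volume (Metric.ball (c i) R) := by
          simp only [K, Complex.volume_ball]
        rw [hK]
        refine this.trans (setLIntegral_mono' measurableSet_ball fun t ht => ?_)
        rw [Set.indicator_of_mem (hupd t ht)]
      rw [lmarginal_insert _ hmeas hi, Finset.card_insert_of_notMem hi, pow_succ']
      calc h x * (K * K ^ s.card) = (h x * K) * K ^ s.card := by ring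
        _ ≤ (∫⁻ t in Metric.ball (c i) R, h (Function.update x i t)) * K ^ s.card := by gcongr
        _ = ∫⁻ t in Metric.ball (c i) R, h (Function.update x i t) * K ^ s.card :=
            (lintegral_mul_const _ (hmeas.comp (measurable_update x))).symm
        _ ≤ ∫⁻ t in Metric.ball (c i) R,
              (∫⋯∫⁻_s, h ∂fun _ => volume) (Function.update x i t) := by
            refine setLIntegral_mono' measurableSet_ball fun t ht => ih _ (hupd t ht) ?_
            intro j hj
            have hji : j ≠ i := fun e => hi (e ▸ hj)
            rw [Function.update_of_ne hji, hxc j (Finset.mem_insert_of_mem hj)]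
        _ ≤ _ := setLIntegral_le_lintegral _ _
  have hfin := key Finset.univ c (Metric.mem_ball_self hR) fun _ _ => rfl
  rw [lmarginal_univ, Finset.card_univ, hh, Set.indicator_of_mem (Metric.mem_ball_self hR),
    lintegral_indicator measurableSet_ball] at hfin
  exact hfin

/-- The sub-mean value inequality on polydiscs of `SPoint m` for `‖f‖ ^ p`. -/
theorem norm_rpow_mul_volume_polydisc_le {m : ℕ} {f : SPoint m → ℂ} {c : SPoint m} {R p : ℝ}
    (hR : 0 < R) (hp : 0 < p) (hf : DifferentiableOn ℂ f (Metric.ball c R)) :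
    ENNReal.ofReal (‖f c‖ ^ p) * volume (Metric.ball (0 : ℂ) R) ^ (m + 1) ≤
      ∫⁻ z in Metric.ball c R, ENNReal.ofReal (‖f z‖ ^ p) := by
  obtain ⟨c₁, c₂⟩ := c
  rw [← ball_prod_same] at hf ⊢
  set K := volume (Metric.ball (0 : ℂ) R) with hK
  have hmeas : AEMeasurable (fun z => ENNReal.ofReal (‖f z‖ ^ p))
      ((volume.prod volume).restrict (Metric.ball c₁ R ×ˢ Metric.ball c₂ R)) :=
    (ENNReal.continuous_ofReal.comp_continuousOn (hf.continuousOn.norm.rpow_const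
      fun _ _ => Or.inr hp.le)).aemeasurable (measurableSet_ball.prod measurableSet_ball)
  rw [← Measure.prod_restrict] at hmeas
  rw [Measure.volume_eq_prod, ← Measure.prod_restrict, lintegral_prod_symm _ hmeas]
  have hlast : ENNReal.ofReal (‖f (c₁, c₂)‖ ^ p) * K ≤
      ∫⁻ t in Metric.ball c₂ R, ENNReal.ofReal (‖f (c₁, t)‖ ^ p) := by
    have := norm_rpow_mul_volume_ball_le (f := fun t => f (c₁, t)) (c := c₂) (R := R) hp
      (hf.comp (by fun_prop) fun t ht => ⟨Metric.mem_ball_self hR, ht⟩)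
    rwa [Complex.volume_ball, ← Complex.volume_ball 0, ← hK] at this
  have hKtop : K ^ m ≠ ⊤ := ENNReal.pow_ne_top measure_ball_lt_top.ne
  calc ENNReal.ofReal (‖f (c₁, c₂)‖ ^ p) * K ^ (m + 1)
      = (ENNReal.ofReal (‖f (c₁, c₂)‖ ^ p) * K) * K ^ m := by ring
    _ ≤ (∫⁻ t in Metric.ball c₂ R, ENNReal.ofReal (‖f (c₁, t)‖ ^ p)) * K ^ m := by gcongr
    _ = ∫⁻ t in Metric.ball c₂ R, ENNReal.ofReal (‖f (c₁, t)‖ ^ p) * K ^ m :=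
        (lintegral_mul_const' _ _ hKtop).symm
    _ ≤ _ := by
        refine setLIntegral_mono' measurableSet_ball fun t ht => ?_
        have := norm_rpow_mul_volume_pi_ball_le (f := fun x => f (x, t)) (c := c₁) hR hp
          (hf.comp (by fun_prop) fun x hx => ⟨hx, ht⟩)
        rwa [Fintype.card_fin] at this

/-- The automorphism of the Siegel upper half-space given by a dilation followed by a Heisenberg
translation, sending `(0, i)` to `a`. -/
noncomputable def siegelMap {m : ℕ} (a w : SPoint m) : SPoint m :=
  (fun j => (Real.sqrt (srho a) : ℂ) * w.1 j + a.1 j,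
    (srho a : ℂ) * (w.2 - Complex.I) + a.2 +
      2 * Complex.I * Real.sqrt (srho a) * ∑ j, w.1 j * (starRingEnd ℂ) (a.1 j))

theorem differentiable_siegelMap {m : ℕ} (a : SPoint m) : Differentiable ℂ (siegelMap a) := by
  unfold siegelMap
  fun_prop

theorem siegelMap_surjective {m : ℕ} {a : SPoint m} (ha : a ∈ Siegel m) :
    Function.Surjective (siegelMap a) := by
  intro z
  have h0 : 0 < srho a := ha
  have h1 : (srho a : ℂ) ≠ 0 := by exact_mod_cast h0.ne'
  have h2 : (Real.sqrt (srho a) : ℂ) ≠ 0 := by exact_mod_cast (Real.sqrt_pos.2 h0).ne'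
  let x : Fin m → ℂ := fun j => (z.1 j - a.1 j) / Real.sqrt (srho a)
  refine ⟨(x, (z.2 - a.2 - 2 * Complex.I * Real.sqrt (srho a) *
    ∑ j, x j * (starRingEnd ℂ) (a.1 j)) / srho a + Complex.I), Prod.ext ?_ ?_⟩
  · ext j
    simp only [siegelMap, x]
    field_simp
    ring
  · simp only [siegelMap]
    field_simp
    ring

theorem srho_siegelMap {m : ℕ} {a : SPoint m} (ha : a ∈ Siegel m) (w : SPoint m) :
    srho (siegelMap a w) = srho a * srho w := by
  have h0 : 0 < srho a := ha
  have hsq : Real.sqrt (srho a) ^ 2 = srho a := Real.sq_sqrt h0.le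
  set d := Real.sqrt (srho a)
  have hterm : ∀ j, ‖(d : ℂ) * w.1 j + a.1 j‖ ^ 2 =
      srho a * ‖w.1 j‖ ^ 2 + ‖a.1 j‖ ^ 2 + 2 * d * (w.1 j * (starRingEnd ℂ) (a.1 j)).re := by
    intro j
    rw [← hsq]
    simp only [Complex.sq_norm, Complex.normSq_apply, Complex.add_re, Complex.add_im,
      Complex.mul_re, Complex.mul_im, Complex.ofReal_re, Complex.ofReal_im, Complex.conj_re,
      Complex.conj_im]
    ring
  have him : (siegelMap a w).2.im = srho a * (w.2.im - 1) + a.2.im +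
      2 * d * ∑ j, (w.1 j * (starRingEnd ℂ) (a.1 j)).re := by
    rw [← Complex.re_sum]
    simp [siegelMap, d]
  have hdef : a.2.im = srho a + ∑ j, ‖a.1 j‖ ^ 2 := by simp [srho]
  have hw : srho w = w.2.im - ∑ j, ‖w.1 j‖ ^ 2 := rfl
  have hL : srho (siegelMap a w) = (siegelMap a w).2.im - ∑ j, ‖(d : ℂ) * w.1 j + a.1 j‖ ^ 2 := rfl
  rw [hL, him, hw, hdef]
  simp only [hterm, Finset.sum_add_distrib, ← Finset.mul_sum]
  ring

theorem norm_srho2_siegelMap {m : ℕ} {a : SPoint m} (ha : a ∈ Siegel m) (w : SPoint m) :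
    ‖srho2 a (siegelMap a w)‖ = srho a * ‖w.2 + Complex.I‖ / 2 := by
  have h0 : 0 < srho a := ha
  have hterm : ∀ j, a.1 j * (starRingEnd ℂ) ((siegelMap a w).1 j) =
      (Real.sqrt (srho a) : ℂ) * (a.1 j * (starRingEnd ℂ) (w.1 j)) + ((‖a.1 j‖ ^ 2 : ℝ) : ℂ) := by
    intro j
    rw [Complex.sq_norm, ← Complex.mul_conj]
    simp only [siegelMap, map_add, map_mul, Complex.conj_ofReal]
    ring
  have hsum : (∑ j, ((‖a.1 j‖ ^ 2 : ℝ) : ℂ)) = a.2.im - srho a := by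
    rw [← Complex.ofReal_sum]
    simp [srho]
  have himag : (a.2.im : ℂ) = Complex.I / 2 * ((starRingEnd ℂ) a.2 - a.2) := by
    apply Complex.ext
    · simp
      ring
    · simp
  have hconj : (starRingEnd ℂ) (siegelMap a w).2 =
      (srho a : ℂ) * ((starRingEnd ℂ) w.2 + Complex.I) + (starRingEnd ℂ) a.2 -
        2 * Complex.I * Real.sqrt (srho a) * ∑ j, a.1 j * (starRingEnd ℂ) (w.1 j) := by
    simp only [siegelMap, map_add, map_mul, map_sub, map_sum, Complex.conj_ofReal, Complex.conj_I,
      Complex.conj_conj, map_ofNat, mul_comm]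
    ring
  have hmain : srho2 a (siegelMap a w) =
      (srho a : ℂ) * (Complex.I / 2 * (starRingEnd ℂ) (w.2 + Complex.I)) := by
    rw [srho2]
    simp only [hterm, Finset.sum_add_distrib, ← Finset.mul_sum, hsum, hconj, himag, map_add,
      Complex.conj_I]
    linear_combination ((srho a : ℂ) - (Real.sqrt (srho a) : ℂ) *
      ∑ j, a.1 j * (starRingEnd ℂ) (w.1 j)) * Complex.I_sq
  rw [hmain, norm_mul, norm_mul, RCLike.norm_conj]
  simp [abs_of_pos h0]
  ring

/-- `1 - tanh² r`. -/
noncomputable def siegelThreshold (r : ℝ) : ℝ :=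
  1 - ((Real.exp (2 * r) - 1) / (Real.exp (2 * r) + 1)) ^ 2

theorem siegelThreshold_pos (r : ℝ) : 0 < siegelThreshold r := by
  have h := Real.exp_pos (2 * r)
  have : siegelThreshold r = 4 * Real.exp (2 * r) / (Real.exp (2 * r) + 1) ^ 2 := by
    unfold siegelThreshold
    field_simp
    ring
  rw [this]
  positivity

theorem siegelThreshold_two_mul_lt {r : ℝ} (hr : 0 < r) :
    siegelThreshold (2 * r) < siegelThreshold r := by
  have h1 : 1 < Real.exp (2 * r) := Real.one_lt_exp_iff.2 (by linarith)
  have h2 : Real.exp (2 * r) < Real.exp (2 * (2 * r)) := Real.exp_lt_exp.2 (by linarith)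
  unfold siegelThreshold
  have : (Real.exp (2 * r) - 1) / (Real.exp (2 * r) + 1) <
      (Real.exp (2 * (2 * r)) - 1) / (Real.exp (2 * (2 * r)) + 1) := by
    rw [div_lt_div_iff₀ (by linarith) (by linarith)]
    nlinarith
  have h0 : 0 ≤ (Real.exp (2 * r) - 1) / (Real.exp (2 * r) + 1) :=
    div_nonneg (by linarith) (by linarith)
  linarith [pow_lt_pow_left₀ this h0 two_ne_zero]

theorem artanh_lt_iff {x r : ℝ} (hx : x < 1) (hx' : -1 < x) :
    artanh x < r ↔ x < (Real.exp (2 * r) - 1) / (Real.exp (2 * r) + 1) := by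
  have h := Real.exp_pos (2 * r)
  have h1 : 0 < 1 - x := by linarith
  have h2 : 0 < (1 + x) / (1 - x) := div_pos (by linarith) h1
  unfold artanh
  rw [lt_div_iff₀ (by linarith)]
  calc 1 / 2 * Real.log ((1 + x) / (1 - x)) < r
      ↔ Real.log ((1 + x) / (1 - x)) < 2 * r := by constructor <;> intro h <;> linarith
    _ ↔ (1 + x) / (1 - x) < Real.exp (2 * r) := Real.log_lt_iff_lt_exp h2
    _ ↔ _ := by
      rw [div_lt_iff₀ h1]
      constructor <;> intro h <;> nlinarith

theorem artanh_sqrt_lt_iff {q r : ℝ} (hq : 0 < q) (hr : 0 < r) :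
    artanh (Real.sqrt (1 - q)) < r ↔ siegelThreshold r < q := by
  have h1 : 1 < Real.exp (2 * r) := Real.one_lt_exp_iff.2 (by linarith)
  have hs : Real.sqrt (1 - q) < 1 := by
    rw [Real.sqrt_lt' one_pos]
    linarith
  rw [artanh_lt_iff hs (by linarith [Real.sqrt_nonneg (1 - q)]), Real.sqrt_lt'
    (div_pos (by linarith) (by linarith)), siegelThreshold]
  constructor <;> intro h <;> linarith

theorem siegelMap_mem_sball_iff {m : ℕ} {a : SPoint m} (ha : a ∈ Siegel m) {r : ℝ} (hr : 0 < r)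
    (w : SPoint m) : siegelMap a w ∈ sball a r ↔
      siegelThreshold r * ‖w.2 + Complex.I‖ ^ 2 < 4 * srho w := by
  have h0 : 0 < srho a := ha
  have hmem : siegelMap a w ∈ Siegel m ↔ 0 < srho w := by
    change 0 < srho (siegelMap a w) ↔ _
    rw [srho_siegelMap ha, mul_pos_iff_of_pos_left h0]
  change _ ∧ artanh _ < r ↔ _
  rw [hmem]
  by_cases hw : 0 < srho w
  · have him : 0 < w.2.im := by
      have : srho w ≤ w.2.im := sub_le_self _ (by positivity)
      linarith
    have hne : 0 < ‖w.2 + Complex.I‖ := by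
      rw [norm_pos_iff]
      intro h
      have := congrArg Complex.im h
      simp at this
      linarith
    have hq : srho a * srho (siegelMap a w) / ‖srho2 a (siegelMap a w)‖ ^ 2 =
        4 * srho w / ‖w.2 + Complex.I‖ ^ 2 := by
      rw [srho_siegelMap ha, norm_srho2_siegelMap ha]
      field_simp
      ring
    rw [hq, artanh_sqrt_lt_iff (by positivity) hr, lt_div_iff₀ (by positivity)]
    simp [hw]
  · refine ⟨fun h => absurd h.1 hw, fun h => absurd ?_ hw⟩
    have : 0 ≤ siegelThreshold r * ‖w.2 + Complex.I‖ ^ 2 :=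
      mul_nonneg (siegelThreshold_pos r).le (by positivity)
    linarith

theorem continuous_srho {m : ℕ} : Continuous (srho : SPoint m → ℝ) := by
  unfold srho
  fun_prop

theorem isCompact_le_srho {m : ℕ} {s : ℝ} (hs : 0 < s) :
    IsCompact {w : SPoint m | s * ‖w.2 + Complex.I‖ ^ 2 ≤ 4 * srho w} := by
  refine Metric.isCompact_of_isClosed_isBounded
    (isClosed_le (by fun_prop) (continuous_const.mul continuous_srho)) ?_
  refine (Metric.isBounded_closedBall (x := ((0 : Fin m → ℂ), -Complex.I))
    (r := 4 / s + 1)).subset fun w hw => ?_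
  have hw' : s * ‖w.2 + Complex.I‖ ^ 2 ≤ 4 * srho w := hw
  have hsum : 0 ≤ ∑ j, ‖w.1 j‖ ^ 2 := by positivity
  have hrho : srho w = w.2.im - ∑ j, ‖w.1 j‖ ^ 2 := rfl
  have him : w.2.im + 1 ≤ ‖w.2 + Complex.I‖ := by
    simpa using (Complex.abs_im_le_norm (w.2 + Complex.I)).trans' (le_abs_self _)
  have hN : ‖w.2 + Complex.I‖ ≤ 4 / s := by
    rw [le_div_iff₀ hs]
    by_contra! h
    nlinarith [norm_nonneg (w.2 + Complex.I)]
  have hs4 : 0 < 4 / s := by positivity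
  rw [Metric.mem_closedBall, Prod.dist_eq, max_le_iff]
  constructor
  · rw [dist_pi_le_iff (by positivity)]
    intro j
    have hj : ‖w.1 j‖ ^ 2 ≤ ∑ j, ‖w.1 j‖ ^ 2 :=
      Finset.single_le_sum (f := fun j => ‖w.1 j‖ ^ 2) (fun _ _ => by positivity)
        (Finset.mem_univ j)
    have : 0 ≤ s * ‖w.2 + Complex.I‖ ^ 2 := by positivity
    simp only [Pi.zero_apply, dist_zero_right]
    nlinarith [norm_nonneg (w.1 j)]
  · rw [dist_eq_norm, sub_neg_eq_add]
    linarith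

/-- A uniform polydisc radius separating the normalised balls of radius `r` and `2 * r`. -/
theorem exists_ball_subset_lt_srho (m : ℕ) {r : ℝ} (hr : 0 < r) :
    ∃ ε > 0, ∀ w : SPoint m, siegelThreshold r * ‖w.2 + Complex.I‖ ^ 2 < 4 * srho w →
      Metric.ball w ε ⊆
        {v | siegelThreshold (2 * r) * ‖v.2 + Complex.I‖ ^ 2 < 4 * srho v} := by
  obtain ⟨ε, hε, hsub⟩ := (isCompact_le_srho (m := m)
    (siegelThreshold_pos r)).exists_thickening_subset_open
    (isOpen_lt (f := fun v : SPoint m => siegelThreshold (2 * r) * ‖v.2 + Complex.I‖ ^ 2)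
      (by fun_prop) (continuous_const.mul continuous_srho)) (fun w hw => by
      have hw' : siegelThreshold r * ‖w.2 + Complex.I‖ ^ 2 ≤ 4 * srho w := hw
      have hsum : 0 ≤ ∑ j, ‖w.1 j‖ ^ 2 := by positivity
      have hrho : srho w = w.2.im - ∑ j, ‖w.1 j‖ ^ 2 := rfl
      have h0 : 0 ≤ siegelThreshold r * ‖w.2 + Complex.I‖ ^ 2 :=
        mul_nonneg (siegelThreshold_pos r).le (by positivity)
      have him : w.2.im + 1 ≤ ‖w.2 + Complex.I‖ := by
        simpa using (Complex.abs_im_le_norm (w.2 + Complex.I)).trans' (le_abs_self _)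
      have hpos : 0 < ‖w.2 + Complex.I‖ ^ 2 := by
        have : 0 < ‖w.2 + Complex.I‖ := by linarith
        positivity
      exact (mul_lt_mul_of_pos_right (siegelThreshold_two_mul_lt hr) hpos).trans_le hw')
  exact ⟨ε, hε, fun w hw => (Metric.ball_subset_thickening (by exact hw.le) ε).trans hsub⟩

theorem lintegral_comp_smul_add {E : Type*} [NormedAddCommGroup E] [NormedSpace ℝ E]
    [MeasurableSpace E] [BorelSpace E] [FiniteDimensional ℝ E] (ν : Measure E)
    [ν.IsAddHaarMeasure] {g : E → ENNReal} (hg : Measurable g) {δ : ℝ} (hδ : 0 < δ) (b : E) :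
    ENNReal.ofReal (δ ^ Module.finrank ℝ E) * ∫⁻ x, g (δ • x + b) ∂ν = ∫⁻ x, g x ∂ν := by
  have hpow : 0 < δ ^ Module.finrank ℝ E := by positivity
  rw [← lintegral_map (f := fun x => g (x + b)) (g := fun x => δ • x) (by fun_prop)
    (measurable_const_smul δ), Measure.map_addHaar_smul ν hδ.ne', lintegral_smul_measure,
    lintegral_add_right_eq_self, smul_eq_mul, ← mul_assoc, ← ENNReal.ofReal_mul hpow.le,
    abs_of_pos (inv_pos.2 hpow), mul_inv_cancel₀ hpow.ne', ENNReal.ofReal_one, one_mul]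

theorem lintegral_comp_siegelMap {m : ℕ} {a : SPoint m} (ha : a ∈ Siegel m)
    {g : SPoint m → ENNReal} (hg : Measurable g) :
    ENNReal.ofReal (srho a ^ (m + 2)) * ∫⁻ w, g (siegelMap a w) = ∫⁻ z, g z := by
  have h0 : 0 < srho a := ha
  have hmeas : Measurable fun w => g (siegelMap a w) :=
    hg.comp (differentiable_siegelMap a).continuous.measurable
  have hinner : ∀ x : Fin m → ℂ, ENNReal.ofReal (srho a ^ 2) * ∫⁻ y, g (siegelMap a (x, y)) =
      ∫⁻ y, g (Real.sqrt (srho a) • x + a.1, y) := by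
    intro x
    rw [← lintegral_comp_smul_add volume
      (g := fun y => g (Real.sqrt (srho a) • x + a.1, y)) (by fun_prop) h0
      (a.2 - srho a * Complex.I +
        2 * Complex.I * Real.sqrt (srho a) * ∑ j, x j * (starRingEnd ℂ) (a.1 j)),
      Complex.finrank_real_complex]
    congr 2 with y
    refine congrArg g (Prod.ext ?_ ?_)
    · ext j
      simp [siegelMap]
    · simp only [siegelMap, Complex.real_smul]
      ring
  have houter := lintegral_comp_smul_add (E := Fin m → ℂ) volume
    (hg.lintegral_prod_right' (ν := (volume : Measure ℂ))) (Real.sqrt_pos.2 h0) a.1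
  have hfin : Module.finrank ℝ (Fin m → ℂ) = 2 * m := by
    simp [Module.finrank_pi_fintype, Complex.finrank_real_complex, mul_comm]
  rw [hfin, pow_mul, Real.sq_sqrt h0.le] at houter
  rw [Measure.volume_eq_prod, lintegral_prod _ hmeas.aemeasurable,
    lintegral_prod _ hg.aemeasurable, ← houter, pow_add, ENNReal.ofReal_mul (by positivity),
    mul_assoc, ← lintegral_const_mul _ hmeas.lintegral_prod_right']
  simp only [hinner]

theorem measurableSet_siegel (m : ℕ) : MeasurableSet (Siegel m) :=
  (isOpen_lt continuous_const continuous_srho).measurableSet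

theorem measurableSet_sball {m : ℕ} (a : SPoint m) (r : ℝ) : MeasurableSet (sball a r) := by
  suffices Measurable fun w => sbeta a w from
    (measurableSet_siegel m).inter (measurableSet_lt this measurable_const)
  have h1 : Measurable (srho : SPoint m → ℝ) := continuous_srho.measurable
  have h2 : Measurable fun w => srho2 a w := by
    unfold srho2
    fun_prop
  unfold sbeta artanh
  fun_prop

theorem sball_subset_siegel {m : ℕ} (a : SPoint m) (r : ℝ) : sball a r ⊆ Siegel m :=
  fun _ h => h.1

/-- Sub-mean-value estimate for holomorphic functions over Bergman balls. -/
theorem exists_norm_rpow_mul_le_setLIntegral_sball (m : ℕ) {r p : ℝ} (hr : 0 < r) (hp : 0 < p) :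
    ∃ M : ℝ, 0 < M ∧ ∀ a ∈ Siegel m, ∀ f : SPoint m → ℂ, DifferentiableOn ℂ f (Siegel m) →
      ∀ z ∈ sball a r, ENNReal.ofReal (‖f z‖ ^ p) * ENNReal.ofReal (srho a ^ (m + 2)) ≤
        ENNReal.ofReal M * ∫⁻ v in sball a (2 * r), ENNReal.ofReal (‖f v‖ ^ p) := by
  obtain ⟨ε, hε, hball⟩ := exists_ball_subset_lt_srho m hr
  set K := volume (Metric.ball (0 : ℂ) ε) ^ (m + 1)
  have hK0 : K ≠ 0 := pow_ne_zero _ (Metric.measure_ball_pos volume _ hε).ne'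
  have hKtop : K ≠ ⊤ := ENNReal.pow_ne_top measure_ball_lt_top.ne
  refine ⟨K.toReal⁻¹, inv_pos.2 (ENNReal.toReal_pos hK0 hKtop), fun a ha f hf z hz => ?_⟩
  rw [ENNReal.ofReal_inv_of_pos (ENNReal.toReal_pos hK0 hKtop), ENNReal.ofReal_toReal hKtop]
  obtain ⟨w, rfl⟩ := siegelMap_surjective ha z
  have hmaps : ∀ v ∈ Metric.ball w ε, siegelMap a v ∈ sball a (2 * r) := fun v hv =>
    (siegelMap_mem_sball_iff ha (by positivity) v).2
      (hball w ((siegelMap_mem_sball_iff ha hr w).1 hz) hv)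
  have hmean := norm_rpow_mul_volume_polydisc_le hε hp
    (hf.comp (differentiable_siegelMap a).differentiableOn
      fun v hv => sball_subset_siegel _ _ (hmaps v hv))
  set g := (sball a (2 * r)).indicator fun v => ENNReal.ofReal (‖f v‖ ^ p) with hg
  have hgm : Measurable g := by
    refine ContinuousOn.measurable_indicator ?_ (measurableSet_sball a _)
    refine ENNReal.continuous_ofReal.comp_continuousOn ?_
    exact (hf.continuousOn.mono (sball_subset_siegel _ _)).norm.rpow_const
      fun _ _ => Or.inr hp.le
  have hle : ∫⁻ v in Metric.ball w ε, ENNReal.ofReal (‖(f ∘ siegelMap a) v‖ ^ p) ≤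
      ∫⁻ v, g (siegelMap a v) := by
    refine (setLIntegral_mono' Metric.isOpen_ball.measurableSet fun v hv => ?_).trans
      (setLIntegral_le_lintegral _ _)
    simp [hg, hmaps v hv]
  rw [← lintegral_indicator (measurableSet_sball a _), ← lintegral_comp_siegelMap ha hgm,
    mul_comm, mul_left_comm]
  gcongr
  rw [← ENNReal.div_eq_inv_mul, ENNReal.le_div_iff_mul_le (Or.inl hK0) (Or.inl hKtop)]
  exact hmean.trans hle

/-- Integrals over a family of sets with multiplicity at most `N` sum to at most `N` times the
integral over any set containing the family. -/
theorem tsum_setLIntegral_le_of_ncard_le {α : Type*} [MeasurableSpace α] {ν : Measure α}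
    {U : Set α} (hU : MeasurableSet U) {s : ℕ → Set α} (hs : ∀ k, MeasurableSet (s k))
    (hsU : ∀ k, s k ⊆ U) {N : ℕ}
    (hN : ∀ z ∈ U, {k | z ∈ s k}.Finite ∧ {k | z ∈ s k}.ncard ≤ N)
    {g : α → ENNReal} (hg : AEMeasurable g (ν.restrict U)) :
    ∑' k, ∫⁻ z in s k, g z ∂ν ≤ N * ∫⁻ z in U, g z ∂ν := by
  have hrestrict : ∀ k, ∫⁻ z in s k, g z ∂ν = ∫⁻ z in U, (s k).indicator g z ∂ν := fun k => by
    rw [setLIntegral_indicator (hs k), Set.inter_eq_left.2 (hsU k)]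
  simp only [hrestrict]
  rw [← lintegral_tsum fun k => hg.indicator (hs k),
    ← lintegral_const_mul' _ _ (ENNReal.natCast_ne_top N)]
  refine setLIntegral_mono' hU fun z hz => ?_
  obtain ⟨hfin, hcard⟩ := hN z hz
  rw [tsum_eq_sum (s := hfin.toFinset) fun k hk => by
    rw [Set.indicator_of_notMem]
    simpa using hk]
  calc ∑ k ∈ hfin.toFinset, (s k).indicator g z ≤ ∑ k ∈ hfin.toFinset, g z :=
        Finset.sum_le_sum fun k _ => Set.indicator_le_self _ _ _
    _ = ({k | z ∈ s k}.ncard : ENNReal) * g z := by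
        rw [Finset.sum_const, nsmul_eq_mul, Set.ncard_eq_toFinset_card _ hfin]
    _ ≤ N * g z := by gcongr


/-- if `μ(D(a_k,r)) ≤ C ρ(a_k)^{n+1}` for an `r`-lattice `(a_k)`, then
`μ` is a Carleson measure for `Aᵖ(𝒰)`. -/
theorem lattice_implies_carleson (n : ℕ) (hn : 1 ≤ n) (p : ℝ) (hp : 0 < p)
    (r : ℝ) (hr : 0 < r) (μ : Measure (SPoint (n - 1)))
    (a : ℕ → SPoint (n - 1)) (ha : ∀ k, a k ∈ Siegel (n - 1))
    (hcover : Siegel (n - 1) = ⋃ k, sball (a k) r)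
    (N : ℕ) (hN : 0 < N)
    (hmult : ∀ z ∈ Siegel (n - 1),
      ({k : ℕ | z ∈ sball (a k) (2 * r)}).Finite ∧
      ({k : ℕ | z ∈ sball (a k) (2 * r)}).ncard ≤ N)
    (C : ℝ) (hC : 0 < C)
    (hμ : ∀ k, μ (sball (a k) r) ≤ ENNReal.ofReal (C * srho (a k) ^ (n + 1))) :
    ∃ C' : ℝ, 0 < C' ∧ ∀ f : SPoint (n - 1) → ℂ, MemAp n p f →
      ∫⁻ z in Siegel (n - 1), ENNReal.ofReal (‖f z‖ ^ p) ∂μ ≤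
        ENNReal.ofReal C' *
          ∫⁻ z in Siegel (n - 1), ENNReal.ofReal (‖f z‖ ^ p) := by
  have hn2 : n + 1 = n - 1 + 2 := by omega
  rw [hn2] at hμ
  unfold MemAp
  clear hn hn2
  generalize n - 1 = m at *
  obtain ⟨M, hM, hloc⟩ := exists_norm_rpow_mul_le_setLIntegral_sball m hr hp
  refine ⟨C * M * N, by positivity, fun f hf => ?_⟩
  have hk : ∀ k, ∫⁻ z in sball (a k) r, ENNReal.ofReal (‖f z‖ ^ p) ∂μ ≤
      ENNReal.ofReal (C * M) *
        ∫⁻ z in sball (a k) (2 * r), ENNReal.ofReal (‖f z‖ ^ p) := by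
    intro k
    have hρ : 0 < srho (a k) ^ (m + 2) := pow_pos (ha k) _
    set J := ∫⁻ z in sball (a k) (2 * r), ENNReal.ofReal (‖f z‖ ^ p)
    calc ∫⁻ z in sball (a k) r, ENNReal.ofReal (‖f z‖ ^ p) ∂μ
        ≤ ∫⁻ _ in sball (a k) r, ENNReal.ofReal M * J / ENNReal.ofReal (srho (a k) ^ (m + 2)) ∂μ :=
          setLIntegral_mono' (measurableSet_sball _ _) fun z hz =>
            (ENNReal.le_div_iff_mul_le (Or.inl (ENNReal.ofReal_pos.2 hρ).ne')
              (Or.inl ENNReal.ofReal_ne_top)).2 (hloc (a k) (ha k) f hf.1 z hz)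
      _ = ENNReal.ofReal M * J / ENNReal.ofReal (srho (a k) ^ (m + 2)) * μ (sball (a k) r) :=
          setLIntegral_const _ _
      _ ≤ ENNReal.ofReal M * J / ENNReal.ofReal (srho (a k) ^ (m + 2)) *
          ENNReal.ofReal (C * srho (a k) ^ (m + 2)) := by
          gcongr
          exact hμ k
      _ = ENNReal.ofReal (C * M) * J := by
          rw [ENNReal.ofReal_mul hC.le, ENNReal.ofReal_mul hC.le, mul_left_comm,
            ENNReal.div_mul_cancel (ENNReal.ofReal_pos.2 hρ).ne' ENNReal.ofReal_ne_top, mul_assoc]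
  calc ∫⁻ z in Siegel m, ENNReal.ofReal (‖f z‖ ^ p) ∂μ
      ≤ ∑' k, ∫⁻ z in sball (a k) r, ENNReal.ofReal (‖f z‖ ^ p) ∂μ := by
        rw [hcover]
        exact lintegral_iUnion_le _ _
    _ ≤ ∑' k, ENNReal.ofReal (C * M) *
        ∫⁻ z in sball (a k) (2 * r), ENNReal.ofReal (‖f z‖ ^ p) := ENNReal.tsum_le_tsum hk
    _ = ENNReal.ofReal (C * M) *
        ∑' k, ∫⁻ z in sball (a k) (2 * r), ENNReal.ofReal (‖f z‖ ^ p) := ENNReal.tsum_mul_left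
    _ ≤ ENNReal.ofReal (C * M) *
        (N * ∫⁻ z in Siegel m, ENNReal.ofReal (‖f z‖ ^ p)) := by
        gcongr
        refine tsum_setLIntegral_le_of_ncard_le (measurableSet_siegel m)
          (fun k => measurableSet_sball _ _) (fun k => sball_subset_siegel _ _) hmult ?_
        exact (ENNReal.continuous_ofReal.comp_continuousOn (hf.1.continuousOn.norm.rpow_const
          fun _ _ => Or.inr hp.le)).aemeasurable (measurableSet_siegel m)
    _ = _ := by
        rw [ENNReal.ofReal_mul (q := (N : ℝ)) (by positivity), ENNReal.ofReal_natCast, mul_assoc]
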